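/- arXiv:1904.09345 — 5 statements merged into one kernel-verified Lean document; each statement's English description precedes it below -/
import Mathlib

section
/- Let H₁ and H₂ be complex Hilbert spaces and e : H₁ → H₂ a continuous linear equivalence (a bounded bijective linear map with bounded inverse). Let K ⊆ H₁ be a closed subspace and R ⊆ K a subspace. Then the orthogonal complement of R inside K (that is, K ∩ R^⊥ taken in H₁) and the orthogonal complement of e(R) inside e(K) (that is, e(K) ∩ (e(R))^⊥ taken in H₂) have the same dimension as complex vector spaces (equal ranks, possibly infinite cardinals). -/
/-- The orthogonal complement of `S` inside a larger subspace `K` represents the quotient `K ⧸ S`. -/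
noncomputable def quotientSubmoduleOfEquivInfOrthogonal {𝕜 H : Type*} [RCLike 𝕜]
    [NormedAddCommGroup H] [InnerProductSpace 𝕜 H] {K S : Submodule 𝕜 H}
    [S.HasOrthogonalProjection] (hSK : S ≤ K) :
    (K ⧸ S.submoduleOf K) ≃ₗ[𝕜] ↥(K ⊓ Sᗮ) :=
  (Submodule.quotientEquivOfIsCompl _ ((K ⊓ Sᗮ).submoduleOf K) (by
    constructor
    · rw [Submodule.disjoint_def]
      rintro ⟨x, hx⟩ hxS hxO
      have h : x ∈ S ⊓ Sᗮ := ⟨hxS, hxO.2⟩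
      rw [Submodule.inf_orthogonal_eq_bot] at h
      simpa using h
    · rw [codisjoint_iff, eq_top_iff]
      rintro ⟨x, hx⟩ -
      rw [← Submodule.sup_orthogonal_inf_of_hasOrthogonalProjection hSK] at hx
      obtain ⟨y, hy, z, hz, rfl⟩ := Submodule.mem_sup.1 hx
      exact Submodule.mem_sup.2
        ⟨⟨y, hSK hy⟩, hy, ⟨z, hz.2⟩, ⟨hz.2, hz.1⟩, rfl⟩)).trans
    (Submodule.submoduleOfEquivOfLe inf_le_left)

/-- A linear equivalence identifies the quotient `K ⧸ S` with the quotient of the images. -/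
noncomputable def quotientSubmoduleOfMapEquiv {𝕜 E F : Type*} [Ring 𝕜]
    [AddCommGroup E] [Module 𝕜 E] [AddCommGroup F] [Module 𝕜 F]
    (e : E ≃ₗ[𝕜] F) (K S : Submodule 𝕜 E) (hSK : S ≤ K) :
    (K ⧸ S.submoduleOf K) ≃ₗ[𝕜] (K.map (e : E →ₗ[𝕜] F) ⧸
      (S.map (e : E →ₗ[𝕜] F)).submoduleOf (K.map (e : E →ₗ[𝕜] F))) :=
  Submodule.Quotient.equiv _ _ (e.submoduleMap K) (by
    ext ⟨y, hy⟩
    constructor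
    · rintro ⟨x, hx, hxy⟩
      exact ⟨x, hx, congrArg Subtype.val hxy⟩
    · rintro ⟨x, hx, hxy⟩
      exact ⟨⟨x, hSK hx⟩, hx, Subtype.ext hxy⟩)

/-- A continuous linear equivalence `e : H₁ ≃L H₂` preserves the dimension of the orthogonal
complement of a subspace `R` inside a closed subspace `K ⊇ R`. -/
theorem stmt_3 {H₁ : Type u} {H₂ : Type v}
    [NormedAddCommGroup H₁] [InnerProductSpace ℂ H₁] [CompleteSpace H₁]
    [NormedAddCommGroup H₂] [InnerProductSpace ℂ H₂] [CompleteSpace H₂]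
    (e : H₁ ≃L[ℂ] H₂) (K R : Submodule ℂ H₁)
    (hK : IsClosed (K : Set H₁)) (hR : R ≤ K) :
    Cardinal.lift.{v} (Module.rank ℂ ↥(K ⊓ Rᗮ)) =
      Cardinal.lift.{u}
        (Module.rank ℂ ↥((K.map (e : H₁ →ₗ[ℂ] H₂)) ⊓ (R.map (e : H₁ →ₗ[ℂ] H₂))ᗮ)) := by
  have hSK : R.topologicalClosure ≤ K := R.topologicalClosure_minimal hR hK
  have hmap : R.topologicalClosure.map (e : H₁ →ₗ[ℂ] H₂) =
      (R.map (e : H₁ →ₗ[ℂ] H₂)).topologicalClosure :=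
    SetLike.coe_injective (e.toHomeomorph.image_closure (R : Set H₁))
  have hSK' := Submodule.map_mono (f := (e : H₁ →ₗ[ℂ] H₂)) hSK
  have q := quotientSubmoduleOfMapEquiv e.toLinearEquiv K _ hSK
  change _ ≃ₗ[ℂ] (K.map (e : H₁ →ₗ[ℂ] H₂) ⧸ (R.topologicalClosure.map
    (e : H₁ →ₗ[ℂ] H₂)).submoduleOf (K.map (e : H₁ →ₗ[ℂ] H₂))) at q
  rw [hmap] at q hSK'
  rw [← R.orthogonal_closure, ← (R.map (e : H₁ →ₗ[ℂ] H₂)).orthogonal_closure]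
  exact ((quotientSubmoduleOfEquivInfOrthogonal hSK).symm.trans
    (q.trans (quotientSubmoduleOfEquivInfOrthogonal hSK'))).lift_rank_eq
end

section
/- Fix 1 ≤ j ≤ n. Let φ : ℂⁿ → ℝ be continuously differentiable, u : ℂⁿ → ℂ continuously differentiable, and v : ℂⁿ → ℂ continuously differentiable with compact support. Then ∫_{ℂⁿ} (∂u/∂z̄_j) · conj(v) · e^{-φ} dV = ∫_{ℂⁿ} u · conj( -∂v/∂z_j + (∂φ/∂z_j) v ) · e^{-φ} dV. In other words, the formal adjoint of ∂/∂z̄_j with respect to the weighted inner product (f,g) = ∫ f·conj(g)·e^{-φ} dV is -∂/∂z_j + ∂φ/∂z_j = -e^{φ} ∂/∂z_j (e^{-φ} ·). -/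
open MeasureTheory

/-- The Wirtinger derivative `∂f/∂z_j = (1/2)(∂f/∂x_j - i ∂f/∂y_j)` of `f : ℂⁿ → ℂ`. -/
noncomputable def wirtingerZ {n : ℕ} (j : Fin n) (f : (Fin n → ℂ) → ℂ) (z : Fin n → ℂ) : ℂ :=
  (1 / 2) * (fderiv ℝ f z (Pi.single j 1) - Complex.I * fderiv ℝ f z (Pi.single j Complex.I))

/-- The Wirtinger derivative `∂f/∂z̄_j = (1/2)(∂f/∂x_j + i ∂f/∂y_j)` of `f : ℂⁿ → ℂ`. -/
noncomputable def wirtingerZbar {n : ℕ} (j : Fin n) (f : (Fin n → ℂ) → ℂ) (z : Fin n → ℂ) : ℂ :=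
  (1 / 2) * (fderiv ℝ f z (Pi.single j 1) + Complex.I * fderiv ℝ f z (Pi.single j Complex.I))

/-- Integration by parts for a directional derivative against a compactly supported function. -/
lemma integral_fderiv_mul_eq_neg_of_hasCompactSupport {n : ℕ} {u w : (Fin n → ℂ) → ℂ}
    (hu : ContDiff ℝ 1 u) (hw : ContDiff ℝ 1 w) (hws : HasCompactSupport w) (e : Fin n → ℂ) :
    Integrable (fun z => fderiv ℝ u z e * w z) ∧ Integrable (fun z => u z * fderiv ℝ w z e) ∧
      ∫ z, fderiv ℝ u z e * w z = -∫ z, u z * fderiv ℝ w z e := by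
  have hu' : Continuous fun z => fderiv ℝ u z e :=
    (hu.continuous_fderiv one_ne_zero).clm_apply continuous_const
  have hw' : Continuous fun z => fderiv ℝ w z e :=
    (hw.continuous_fderiv one_ne_zero).clm_apply continuous_const
  have h₁ : Integrable (fun z => fderiv ℝ u z e * w z) :=
    (hu'.mul hw.continuous).integrable_of_hasCompactSupport hws.mul_left
  have h₂ : Integrable (fun z => u z * fderiv ℝ w z e) :=
    (hu.continuous.mul hw').integrable_of_hasCompactSupport (hws.fderiv_apply ℝ e).mul_left
  refine ⟨h₁, h₂, ?_⟩
  rw [integral_mul_fderiv_eq_neg_fderiv_mul_of_integrable h₁ h₂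
    ((hu.continuous.mul hw.continuous).integrable_of_hasCompactSupport hws.mul_left)
    (fun z _ => hu.differentiable one_ne_zero z) (fun z _ => hw.differentiable one_ne_zero z),
    neg_neg]

/-- Integration by parts for `∂/∂z̄_j` against a compactly supported function. -/
lemma integral_wirtingerZbar_mul_eq_neg {n : ℕ} (j : Fin n) {u w : (Fin n → ℂ) → ℂ}
    (hu : ContDiff ℝ 1 u) (hw : ContDiff ℝ 1 w) (hws : HasCompactSupport w) :
    ∫ z, wirtingerZbar j u z * w z = -∫ z, u z * wirtingerZbar j w z := by
  obtain ⟨a₁, b₁, h₁⟩ :=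
    integral_fderiv_mul_eq_neg_of_hasCompactSupport hu hw hws (Pi.single j 1)
  obtain ⟨a₂, b₂, h₂⟩ :=
    integral_fderiv_mul_eq_neg_of_hasCompactSupport hu hw hws (Pi.single j Complex.I)
  have hl : ∀ z, wirtingerZbar j u z * w z = (1 / 2) * (fderiv ℝ u z (Pi.single j 1) * w z +
      Complex.I * (fderiv ℝ u z (Pi.single j Complex.I) * w z)) := fun z => by
    unfold wirtingerZbar; ring
  have hr : ∀ z, u z * wirtingerZbar j w z = (1 / 2) * (u z * fderiv ℝ w z (Pi.single j 1) +
      Complex.I * (u z * fderiv ℝ w z (Pi.single j Complex.I))) := fun z => by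
    unfold wirtingerZbar; ring
  simp_rw [hl, hr]
  rw [integral_const_mul, integral_const_mul, integral_add a₁ (a₂.const_mul _),
    integral_add b₁ (b₂.const_mul _), integral_const_mul, integral_const_mul, h₁, h₂]
  ring

/-- The conjugate of `-∂v/∂z_j + (∂φ/∂z_j) v`, times `e^{-φ}`, is `-∂/∂z̄_j (conj(v) e^{-φ})`. -/
lemma wirtingerZbar_conj_mul_exp_neg {n : ℕ} (j : Fin n) {φ : (Fin n → ℂ) → ℝ}
    {v : (Fin n → ℂ) → ℂ} {z : Fin n → ℂ} (hφ : DifferentiableAt ℝ φ z)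
    (hv : DifferentiableAt ℝ v z) :
    wirtingerZbar j (fun y => (starRingEnd ℂ) (v y) * (Real.exp (-(φ y)) : ℂ)) z =
      -((starRingEnd ℂ) (-(wirtingerZ j v z) + wirtingerZ j (fun y => ((φ y : ℝ) : ℂ)) z * v z) *
        (Real.exp (-(φ z)) : ℂ)) := by
  have hc : HasFDerivAt (fun y => ((φ y : ℝ) : ℂ)) (Complex.ofRealCLM ∘L fderiv ℝ φ z) z :=
    Complex.ofRealCLM.hasFDerivAt.comp z hφ.hasFDerivAt
  have hE := Complex.ofRealCLM.hasFDerivAt.comp z hφ.hasFDerivAt.fun_neg.exp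
  have hV := Complex.conjCLE.toContinuousLinearMap.hasFDerivAt.comp z hv.hasFDerivAt
  have hw : HasFDerivAt (fun y => (starRingEnd ℂ) (v y) * (Real.exp (-(φ y)) : ℂ)) _ z :=
    hV.mul hE
  unfold wirtingerZbar wirtingerZ
  rw [hw.fderiv, hc.fderiv]
  simp [map_ofNat (starRingEnd ℂ) 2]
  ring

/-- Weighted integration by parts: the formal adjoint of `∂/∂z̄_j` with respect to the
inner product `(f,g) = ∫ f conj(g) e^{-φ} dV` is `-∂/∂z_j + (∂φ/∂z_j)`. -/
theorem stmt_5 {n : ℕ} (j : Fin n) (φ : (Fin n → ℂ) → ℝ) (hφ : ContDiff ℝ 1 φ)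
    (u v : (Fin n → ℂ) → ℂ) (hu : ContDiff ℝ 1 u) (hv : ContDiff ℝ 1 v)
    (hvs : HasCompactSupport v) :
    ∫ z : Fin n → ℂ, wirtingerZbar j u z * (starRingEnd ℂ) (v z) * (Real.exp (-(φ z)) : ℂ) =
    ∫ z : Fin n → ℂ, u z * (starRingEnd ℂ)
        (-(wirtingerZ j v z) + wirtingerZ j (fun y => ((φ y : ℝ) : ℂ)) z * v z) *
      (Real.exp (-(φ z)) : ℂ) := by
  have hws : HasCompactSupport
      fun y => (starRingEnd ℂ) (v y) * (Real.exp (-(φ y)) : ℂ) :=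
    (hvs.comp_left (map_zero (starRingEnd ℂ))).mul_right
  have hw : ContDiff ℝ 1 fun y => (starRingEnd ℂ) (v y) * (Real.exp (-(φ y)) : ℂ) :=
    (Complex.conjCLE.contDiff.comp hv).mul (Complex.ofRealCLM.contDiff.comp hφ.neg.exp)
  simp_rw [mul_assoc]
  rw [integral_wirtingerZbar_mul_eq_neg j hu hw hws, ← integral_neg]
  refine integral_congr_ae (.of_forall fun z => ?_)
  simp only [wirtingerZbar_conj_mul_exp_neg j (hφ.differentiable one_ne_zero z)
    (hv.differentiable one_ne_zero z), mul_neg, neg_neg]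
end

section
/- Let ψ₃ : ℝ → ℝ be a smooth compactly supported function with ψ₃ ≡ 1 in a neighborhood of 0 and ∫_ℝ |ψ₃(x)|² dx = 1. Define ψ₂ : ℂ → ℂ by ψ₂(x + iy) = ψ₃(y)·(ψ₃(x) + i y ψ₃'(x) − (y²/2) ψ₃''(x)). Then ψ₂ is smooth with compact support, and for every real x: (a) (∂ψ₂/∂z̄)(x) = 0; (b) (∂²ψ₂/∂z̄²)(x) = 0; and (c) ∫_ℝ |ψ₂(x)|² dx = 1. -/
open MeasureTheory

/-- The Wirtinger derivative `∂f/∂z̄ = (1/2)(∂f/∂x + i ∂f/∂y)` of `f : ℂ → ℂ`. -/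
noncomputable def wirtingerZbar1 (f : ℂ → ℂ) (z : ℂ) : ℂ :=
  (1 / 2) * (fderiv ℝ f z 1 + Complex.I * fderiv ℝ f z Complex.I)

/-- The chain rule for `z ↦ f (re z)`, where `f` is a real function. -/
theorem HasDerivAt.hasFDerivAt_ofReal_comp_re {f : ℝ → ℝ} {f' : ℝ} {z : ℂ}
    (hf : HasDerivAt f f' z.re) :
    HasFDerivAt (fun w : ℂ => (f w.re : ℂ))
      (Complex.ofRealCLM.comp (f' • Complex.reCLM)) z :=
  Complex.ofRealCLM.hasFDerivAt.comp z
    (hf.comp_hasFDerivAt z Complex.reCLM.hasFDerivAt)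

/-- The chain rule for `z ↦ f (im z)`, where `f` is a real function. -/
theorem HasDerivAt.hasFDerivAt_ofReal_comp_im {f : ℝ → ℝ} {f' : ℝ} {z : ℂ}
    (hf : HasDerivAt f f' z.im) :
    HasFDerivAt (fun w : ℂ => (f w.im : ℂ))
      (Complex.ofRealCLM.comp (f' • Complex.imCLM)) z :=
  Complex.ofRealCLM.hasFDerivAt.comp z
    (hf.comp_hasFDerivAt z Complex.imCLM.hasFDerivAt)

theorem Filter.EventuallyEq.wirtingerZbar1_eq {f g : ℂ → ℂ} {z : ℂ} (h : f =ᶠ[nhds z] g) :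
    wirtingerZbar1 f z = wirtingerZbar1 g z := by
  simp only [wirtingerZbar1, h.fderiv_eq]

/-- The Wirtinger derivative of the second order almost analytic extension of `g`. -/
theorem wirtingerZbar1_almostAnalytic {g g₁ g₂ : ℝ → ℝ} {g₃ : ℝ} {z : ℂ}
    (h : HasDerivAt g (g₁ z.re) z.re) (h₁ : HasDerivAt g₁ (g₂ z.re) z.re)
    (h₂ : HasDerivAt g₂ g₃ z.re) :
    wirtingerZbar1 (fun w : ℂ => (g w.re : ℂ) + Complex.I * (w.im : ℂ) * (g₁ w.re : ℂ)
      - ((w.im ^ 2 / 2 : ℝ) : ℂ) * (g₂ w.re : ℂ)) z = -((z.im ^ 2 / 4 : ℝ) : ℂ) * (g₃ : ℂ) := by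
  have hy : HasDerivAt (fun y : ℝ => y) 1 z.im := hasDerivAt_id _
  have hy₂ : HasDerivAt (fun y : ℝ => y ^ 2 / 2) z.im z.im := by
    simpa using (hasDerivAt_pow 2 z.im).div_const 2
  have key := (h.hasFDerivAt_ofReal_comp_re.add
    ((hy.hasFDerivAt_ofReal_comp_im.const_mul Complex.I).mul h₁.hasFDerivAt_ofReal_comp_re)).sub
    (hy₂.hasFDerivAt_ofReal_comp_im.mul h₂.hasFDerivAt_ofReal_comp_re)
  have key' := key.fderiv
  simp only [Pi.add_def, Pi.sub_def, Pi.mul_def] at key'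
  rw [wirtingerZbar1, key']
  simp
  linear_combination (1 / 2 : ℂ) * g₁ z.re * Complex.I_sq

theorem wirtingerZbar1_im_sq_mul {g : ℝ → ℝ} {x g' : ℝ} (h : HasDerivAt g g' x) :
    wirtingerZbar1 (fun w : ℂ => -((w.im ^ 2 / 4 : ℝ) : ℂ) * (g w.re : ℂ)) (x : ℂ) = 0 := by
  have hy : HasDerivAt (fun y : ℝ => y ^ 2 / 4) 0 (x : ℂ).im := by
    simpa using (hasDerivAt_pow 2 (x : ℂ).im).div_const 4
  have hx : HasDerivAt g g' (x : ℂ).re := h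
  have key := (hy.hasFDerivAt_ofReal_comp_im.neg.mul hx.hasFDerivAt_ofReal_comp_re).fderiv
  simp only [Pi.neg_def, Pi.mul_def] at key
  rw [wirtingerZbar1, key]
  simp

/-- The auxiliary function `ψ₂(x+iy) = ψ₃(y)(ψ₃(x) + iyψ₃'(x) - (y²/2)ψ₃''(x))` is smooth with
compact support, its `∂/∂z̄` and `∂²/∂z̄²` vanish on the real axis, and `∫_ℝ |ψ₂(x)|² dx = 1`. -/
theorem stmt_7 (ψ₃ : ℝ → ℝ) (hψ₃ : ContDiff ℝ (⊤ : ℕ∞) ψ₃) (hsupp : HasCompactSupport ψ₃)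
    (hone : ∀ᶠ x in nhds (0 : ℝ), ψ₃ x = 1) (hint : ∫ x : ℝ, (ψ₃ x) ^ 2 = 1)
    (ψ₂ : ℂ → ℂ)
    (hψ₂ : ∀ z : ℂ, ψ₂ z = (ψ₃ z.im : ℂ) *
      ((ψ₃ z.re : ℂ) + Complex.I * (z.im : ℂ) * ((deriv ψ₃ z.re : ℝ) : ℂ)
        - ((z.im ^ 2 / 2 : ℝ) : ℂ) * ((deriv (deriv ψ₃) z.re : ℝ) : ℂ))) :
    ContDiff ℝ (⊤ : ℕ∞) ψ₂ ∧ HasCompactSupport ψ₂ ∧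
    (∀ x : ℝ, wirtingerZbar1 ψ₂ (x : ℂ) = 0) ∧
    (∀ x : ℝ, wirtingerZbar1 (fun z => wirtingerZbar1 ψ₂ z) (x : ℂ) = 0) ∧
    ∫ x : ℝ, ‖ψ₂ (x : ℂ)‖ ^ 2 = 1 := by
  have hd : ContDiff ℝ (⊤ : ℕ∞) (deriv ψ₃) := (contDiff_infty_iff_deriv.mp hψ₃).2
  have hd₂ : ContDiff ℝ (⊤ : ℕ∞) (deriv (deriv ψ₃)) := (contDiff_infty_iff_deriv.mp hd).2
  have hd₃ : ContDiff ℝ (⊤ : ℕ∞) (deriv (deriv (deriv ψ₃))) := (contDiff_infty_iff_deriv.mp hd₂).2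
  have hasDeriv {f : ℝ → ℝ} (hf : ContDiff ℝ (⊤ : ℕ∞) f) (x : ℝ) : HasDerivAt f (deriv f x) x :=
    ((contDiff_infty_iff_deriv.mp hf).1 x).hasDerivAt
  have him (x : ℝ) : Filter.Tendsto Complex.im (nhds (x : ℂ)) (nhds 0) := by
    simpa using Complex.continuous_im.tendsto (x : ℂ)
  have hzbar {z : ℂ} (hz : ∀ᶠ y in nhds z.im, ψ₃ y = 1) :
      wirtingerZbar1 ψ₂ z =
        -((z.im ^ 2 / 4 : ℝ) : ℂ) * ((deriv (deriv (deriv ψ₃)) z.re : ℝ) : ℂ) := by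
    rw [← wirtingerZbar1_almostAnalytic (hasDeriv hψ₃ _) (hasDeriv hd _) (hasDeriv hd₂ _)]
    refine Filter.EventuallyEq.wirtingerZbar1_eq ?_
    filter_upwards [Complex.continuous_im.continuousAt.eventually hz] with w hw
    simp [hψ₂, hw]
  refine ⟨?_, ?_, fun x => ?_, fun x => ?_, ?_⟩
  · have hre : ContDiff ℝ (⊤ : ℕ∞) Complex.re := Complex.reCLM.contDiff
    have him' : ContDiff ℝ (⊤ : ℕ∞) Complex.im := Complex.imCLM.contDiff
    have hofReal {f : ℂ → ℝ} (hf : ContDiff ℝ (⊤ : ℕ∞) f) :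
        ContDiff ℝ (⊤ : ℕ∞) (fun z => (f z : ℂ)) := Complex.ofRealCLM.contDiff.comp hf
    rw [funext hψ₂]
    exact (hofReal (hψ₃.comp him')).mul
      (((hofReal (hψ₃.comp hre)).add
        ((contDiff_const.mul (hofReal him')).mul (hofReal (hd.comp hre)))).sub
        ((hofReal ((him'.pow 2).div_const 2)).mul (hofReal (hd₂.comp hre))))
  · refine HasCompactSupport.intro (hsupp.isCompact.reProdIm hsupp.isCompact) fun z hz => ?_
    rw [hψ₂]
    by_cases hy : z.im ∈ tsupport ψ₃
    · have hx : z.re ∉ tsupport ψ₃ := fun hx => hz (Complex.mem_reProdIm.mpr ⟨hx, hy⟩)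
      have hx₁ : z.re ∉ tsupport (deriv ψ₃) := fun h =>
        hx (closure_minimal support_deriv_subset (isClosed_tsupport ψ₃) h)
      have hx₂ : deriv (deriv ψ₃) z.re = 0 :=
        Function.notMem_support.mp fun h => hx₁ (support_deriv_subset h)
      simp [image_eq_zero_of_notMem_tsupport hx, image_eq_zero_of_notMem_tsupport hx₁, hx₂]
    · simp [image_eq_zero_of_notMem_tsupport hy]
  · rw [hzbar (z := x) (by simpa using hone)]
    simp
  · rw [← wirtingerZbar1_im_sq_mul (hasDeriv hd₃ x)]
    refine Filter.EventuallyEq.wirtingerZbar1_eq ?_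
    filter_upwards [(him x).eventually hone.eventually_nhds] with z hz
    exact hzbar hz
  · simpa [hψ₂, hone.self_of_nhds] using hint
end

section
/- Let ψ : ℝ → ℝ be a smooth nondecreasing function with ψ(x) = 0 for x ≤ 0 and ψ(x) = 1 for x ≥ 1. Let Ω ⊆ ℂⁿ be open and bounded, and let ρ : ℂⁿ → ℝ be continuous on ℂⁿ, smooth on Ω, with Ω = {z : ρ(z) < 0} and sup_Ω |∇ρ| = M < ∞. For t > 0 and a constant C_t > 0, define χ_t : ℂⁿ → ℝ by χ_t(z) = √(C_t) · ψ(−tρ(z) − 1) · (−ρ(z)) for z ∈ Ω and χ_t(z) = 0 otherwise. Then: (i) χ_t is smooth on ℂⁿ and its support is a compact subset of Ω contained in {z : ρ(z) ≤ −1/t}; (ii) sup |χ_t| ≤ √(C_t) · sup_Ω |ρ| and |∇χ_t(z)| ≤ √(C_t) · M · (2 sup_ℝ|ψ'| + 1) for all z ∈ Ω; and (iii) C_t · ρ(z)² ≤ χ_t(z)² + 4C_t/t² for every z ∈ Ω. -/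
open Classical

/-- A function equal to `0` on `(-∞, 0]` and to `1` on `[1, ∞)` has derivative zero off `[0, 1]`. -/
theorem deriv_eq_zero_of_notMem_Icc {ψ : ℝ → ℝ} (hψ0 : ∀ x ≤ (0 : ℝ), ψ x = 0)
    (hψ1 : ∀ x : ℝ, 1 ≤ x → ψ x = 1) {x : ℝ} (hx : x ∉ Set.Icc (0 : ℝ) 1) : deriv ψ x = 0 := by
  rcases lt_or_ge x 0 with h | h
  · have : ψ =ᶠ[nhds x] fun _ => 0 := by
      filter_upwards [Iio_mem_nhds h] with y hy using hψ0 y (le_of_lt hy)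
    rw [this.deriv_eq, deriv_const]
  · have h1 : 1 < x := by
      by_contra h1
      exact hx ⟨h, not_lt.1 h1⟩
    have : ψ =ᶠ[nhds x] fun _ => 1 := by
      filter_upwards [Ioi_mem_nhds h1] with y hy using hψ1 y (le_of_lt hy)
    rw [this.deriv_eq, deriv_const]

theorem bddAbove_range_abs_deriv {ψ : ℝ → ℝ} (hψ : ContDiff ℝ 1 ψ)
    (hψ0 : ∀ x ≤ (0 : ℝ), ψ x = 0) (hψ1 : ∀ x : ℝ, 1 ≤ x → ψ x = 1) :
    BddAbove (Set.range fun x => |deriv ψ x|) := by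
  have hc : HasCompactSupport (deriv ψ) :=
    HasCompactSupport.intro isCompact_Icc fun x hx => deriv_eq_zero_of_notMem_Icc hψ0 hψ1 hx
  obtain ⟨C, hC⟩ := hc.exists_bound_of_continuous (hψ.continuous_deriv le_rfl)
  exact ⟨C, Set.forall_mem_range.2 hC⟩

/-- Multiplication by `t r` costs at most a factor `2`, since `|t r| ≤ 2` wherever the derivative
of `ψ` is nonzero at `-t r - 1`. -/
theorem abs_mul_deriv_cutoff_le {ψ : ℝ → ℝ} (hψ : ContDiff ℝ 1 ψ)
    (hψ0 : ∀ x ≤ (0 : ℝ), ψ x = 0) (hψ1 : ∀ x : ℝ, 1 ≤ x → ψ x = 1) (t r : ℝ) :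
    |t * r * deriv ψ (-t * r - 1)| ≤ 2 * ⨆ x : ℝ, |deriv ψ x| := by
  have hle := le_ciSup (bddAbove_range_abs_deriv hψ hψ0 hψ1) (-t * r - 1)
  rw [abs_mul]
  by_cases h : -t * r - 1 ∈ Set.Icc (0 : ℝ) 1
  · have : |t * r| ≤ 2 := abs_le.2 ⟨by linarith [h.2], by linarith [h.1]⟩
    exact mul_le_mul this hle (abs_nonneg _) zero_le_two
  · rw [deriv_eq_zero_of_notMem_Icc hψ0 hψ1 h, abs_zero, mul_zero]
    exact mul_nonneg zero_le_two (Real.iSup_nonneg fun _ => abs_nonneg _)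

/-- The cutoff `χ_t = √C_t · ψ(-tρ-1)·(-ρ)` (extended by `0` outside `Ω`) is smooth, compactly
supported in `Ω ∩ {ρ ≤ -1/t}`, satisfies `C¹` bounds of size `O(√C_t)`, and
`C_t ρ² ≤ χ_t² + 4C_t/t²` on `Ω`. -/
theorem stmt_9 {n : ℕ} (ψ : ℝ → ℝ) (hψ : ContDiff ℝ (⊤ : ℕ∞) ψ) (hmono : Monotone ψ)
    (hψ0 : ∀ x ≤ (0 : ℝ), ψ x = 0) (hψ1 : ∀ x : ℝ, 1 ≤ x → ψ x = 1)
    (Ω : Set (EuclideanSpace ℂ (Fin n))) (hΩo : IsOpen Ω) (hΩb : Bornology.IsBounded Ω)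
    (ρ : EuclideanSpace ℂ (Fin n) → ℝ) (hρc : Continuous ρ)
    (hρs : ContDiffOn ℝ (⊤ : ℕ∞) ρ Ω) (hΩρ : Ω = {z | ρ z < 0})
    (M : ℝ) (hM : IsLUB ((fun z => ‖fderiv ℝ ρ z‖) '' Ω) M)
    (t Ct : ℝ) (ht : 0 < t) (hCt : 0 < Ct)
    (χ : EuclideanSpace ℂ (Fin n) → ℝ)
    (hχ : ∀ z, χ z = if z ∈ Ω then Real.sqrt Ct * ψ (-t * ρ z - 1) * (-ρ z) else 0) :
    (ContDiff ℝ (⊤ : ℕ∞) χ ∧ HasCompactSupport χ ∧ tsupport χ ⊆ Ω ∧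
      tsupport χ ⊆ {z | ρ z ≤ -1 / t}) ∧
    ((∀ z, |χ z| ≤ Real.sqrt Ct * ⨆ w : Ω, |ρ w|) ∧
      (∀ z ∈ Ω, ‖fderiv ℝ χ z‖ ≤ Real.sqrt Ct * M * (2 * (⨆ x : ℝ, |deriv ψ x|) + 1))) ∧
    ∀ z ∈ Ω, Ct * (ρ z) ^ 2 ≤ (χ z) ^ 2 + 4 * Ct / t ^ 2 := by
  have hΩ : ∀ z, z ∈ Ω ↔ ρ z < 0 := fun z => by rw [hΩρ]; rfl
  have hψnn : ∀ x, 0 ≤ ψ x := fun x => by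
    rw [← hψ0 (min x 0) (min_le_right _ _)]
    exact hmono (min_le_left _ _)
  have hψle : ∀ x, ψ x ≤ 1 := fun x => by
    rw [← hψ1 (max x 1) (le_max_right _ _)]
    exact hmono (le_max_left _ _)
  have hψC1 : ContDiff ℝ 1 ψ := hψ.of_le (by exact_mod_cast le_top)
  have hχΩ : ∀ z ∈ Ω, χ z = √Ct * ψ (-t * ρ z - 1) * (-ρ z) := fun z hz => by
    rw [hχ, if_pos hz]
  have hχev : ∀ z ∈ Ω, χ =ᶠ[nhds z] fun z => √Ct * ψ (-t * ρ z - 1) * (-ρ z) := fun z hz => by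
    filter_upwards [hΩo.mem_nhds hz] with w hw using hχΩ w hw
  have hρat : ∀ z ∈ Ω, ContDiffAt ℝ (⊤ : ℕ∞) ρ z := fun z hz =>
    hρs.contDiffAt (hΩo.mem_nhds hz)
  have hKc : IsClosed {z | ρ z ≤ -1 / t} := isClosed_le hρc continuous_const
  have hKΩ : {z | ρ z ≤ -1 / t} ⊆ Ω := fun z hz =>
    (hΩ z).2 (lt_of_le_of_lt hz (div_neg_of_neg_of_pos (by norm_num) ht))
  have hsupp : tsupport χ ⊆ {z | ρ z ≤ -1 / t} := by
    refine closure_minimal (fun z hz => ?_) hKc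
    by_contra hzK
    refine hz ?_
    rw [hχ]
    split_ifs
    · have hlt : -1 / t < ρ z := not_le.1 hzK
      rw [div_lt_iff₀ ht] at hlt
      rw [hψ0 _ (by linarith)]
      ring
    · rfl
  have hcpt : HasCompactSupport χ :=
    (Metric.isCompact_of_isClosed_isBounded hKc (hΩb.subset hKΩ)).of_isClosed_subset
      (isClosed_tsupport χ) hsupp
  refine ⟨⟨?_, hcpt, hsupp.trans hKΩ, hsupp⟩, ⟨fun z => ?_, fun z hz => ?_⟩, fun z hz => ?_⟩
  · refine contDiff_iff_contDiffAt.2 fun z => ?_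
    by_cases hz : z ∈ tsupport χ
    swap
    · exact contDiffAt_const.congr_of_eventuallyEq (notMem_tsupport_iff_eventuallyEq.1 hz)
    have hzΩ := hKΩ (hsupp hz)
    have hρz := hρat z hzΩ
    refine ContDiffAt.congr_of_eventuallyEq ?_ (hχev z hzΩ)
    exact (contDiffAt_const.mul
      (hψ.contDiffAt.comp z ((contDiffAt_const.mul hρz).sub contDiffAt_const))).mul hρz.neg
  · by_cases hz : z ∈ Ω
    · have hbdd : BddAbove (Set.range fun w : Ω => |ρ w|) := by
        obtain ⟨C, hC⟩ := hΩb.isCompact_closure.exists_bound_of_continuousOn hρc.continuousOn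
        exact ⟨C, Set.forall_mem_range.2 fun w => hC w (subset_closure w.2)⟩
      have hle : |ρ z| ≤ ⨆ w : Ω, |ρ w| := le_ciSup hbdd ⟨z, hz⟩
      rw [hχΩ z hz, abs_mul, abs_mul, abs_neg, abs_of_nonneg (Real.sqrt_nonneg _),
        abs_of_nonneg (hψnn _), mul_assoc]
      refine mul_le_mul_of_nonneg_left (le_trans ?_ hle) (Real.sqrt_nonneg _)
      exact mul_le_of_le_one_left (abs_nonneg _) (hψle _)
    · rw [hχ, if_neg hz, abs_zero]
      exact mul_nonneg (Real.sqrt_nonneg _) (Real.iSup_nonneg fun _ => abs_nonneg _)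
  · have hρd : HasFDerivAt ρ (fderiv ℝ ρ z) z :=
      ((hρat z hz).differentiableAt (by simp)).hasFDerivAt
    have hρM : ‖fderiv ℝ ρ z‖ ≤ M := hM.1 ⟨z, hz, rfl⟩
    have hψd : HasDerivAt ψ (deriv ψ (-t * ρ z - 1)) (-t * ρ z - 1) :=
      (hψC1.differentiable one_ne_zero _).hasDerivAt
    have hprofile : HasDerivAt (fun r => √Ct * ψ (-t * r - 1) * (-r))
        (√Ct * (t * ρ z * deriv ψ (-t * ρ z - 1) - ψ (-t * ρ z - 1))) (ρ z) := by
      have hlin : HasDerivAt (fun r : ℝ => -t * r - 1) (-t) (ρ z) := by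
        simpa using ((hasDerivAt_id (ρ z)).const_mul (-t)).sub_const 1
      refine (((hψd.comp (ρ z) hlin).const_mul √Ct).mul (hasDerivAt_id (ρ z)).neg).congr_deriv ?_
      simp only [Function.comp_apply, Pi.neg_apply, id_eq]
      ring
    rw [((hprofile.comp_hasFDerivAt z hρd).congr_of_eventuallyEq (hχev z hz)).fderiv, norm_smul,
      Real.norm_eq_abs, abs_mul, abs_of_nonneg (Real.sqrt_nonneg _), mul_assoc √Ct,
      mul_assoc √Ct, mul_comm M]
    refine mul_le_mul_of_nonneg_left ?_ (Real.sqrt_nonneg _)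
    have hS := abs_mul_deriv_cutoff_le hψC1 hψ0 hψ1 t (ρ z)
    have hcoef : |t * ρ z * deriv ψ (-t * ρ z - 1) - ψ (-t * ρ z - 1)| ≤
        2 * (⨆ x : ℝ, |deriv ψ x|) + 1 := by
      refine (abs_sub _ _).trans (add_le_add hS ?_)
      rw [abs_of_nonneg (hψnn _)]
      exact hψle _
    exact mul_le_mul hcoef hρM (norm_nonneg _) ((abs_nonneg _).trans hcoef)
  · rw [hχΩ z hz]
    rcases le_total 1 (-t * ρ z - 1) with h | h
    · rw [hψ1 _ h, mul_one, mul_pow, Real.sq_sqrt hCt.le, neg_sq]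
      exact le_add_of_nonneg_right (by positivity)
    · have htρ : (t * ρ z) ^ 2 ≤ 2 ^ 2 := by
        have := mul_neg_of_pos_of_neg ht ((hΩ z).1 hz)
        exact sq_le_sq' (by linarith) (by linarith)
      refine le_trans ?_ (le_add_of_nonneg_left (sq_nonneg _))
      rw [le_div_iff₀ (by positivity)]
      nlinarith
end

section
/- Let n ≥ 2 and let φ be a real-valued function that is twice continuously differentiable in a neighborhood of 0 in ℂⁿ. Define the holomorphic polynomial B(z) = (1/2)φ(0) + Σ_{j=1}^{n} (∂φ/∂z_j)(0) z_j + (1/2) Σ_{j,k=1}^{n−1} (∂²φ/∂z_j∂z_k)(0) z_j z_k + Σ_{j=1}^{n−1} (∂²φ/∂z_j∂x_n)(0) z_j z_n + (1/4)(∂²φ/∂x_n²)(0) z_n², where x_n = Re z_n. Fix w = (w₁, …, w_n) ∈ ℂⁿ and for τ > 0 set z(τ) = (τ⁻¹w₁, …, τ⁻¹w_{n−1}, τ⁻¹ Re w_n + i τ⁻² Im w_n). Then lim_{τ→∞} τ² ( φ(z(τ)) − 2 Re B(z(τ)) ) = Σ_{j,k=1}^{n−1} (∂²φ/∂z_j∂z̄_k)(0)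 w_j w̄_k. -/
/-- The index of the last coordinate `z_n`. -/
def lastIdx (n : ℕ) (hn : 2 ≤ n) : Fin n := ⟨n - 1, by omega⟩

/-- The derivative `∂f/∂x_n` in the direction of the real part of the last coordinate. -/
noncomputable def derivXn {n : ℕ} (hn : 2 ≤ n) (f : (Fin n → ℂ) → ℂ) (z : Fin n → ℂ) : ℂ :=
  fderiv ℝ f z (Pi.single (lastIdx n hn) 1)

/-- `φ` viewed as a complex-valued function. -/
noncomputable def cplx {n : ℕ} (φ : (Fin n → ℂ) → ℝ) : (Fin n → ℂ) → ℂ :=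
  fun z => ((φ z : ℝ) : ℂ)

/-- The holomorphic polynomial
`B(z) = (1/2)φ(0) + Σ_j ∂φ/∂z_j(0) z_j + (1/2)Σ_{j,k<n} ∂²φ/∂z_j∂z_k(0) z_j z_k
  + Σ_{j<n} ∂²φ/∂z_j∂x_n(0) z_j z_n + (1/4)∂²φ/∂x_n²(0) z_n²`. -/
noncomputable def Bpoly {n : ℕ} (hn : 2 ≤ n) (φ : (Fin n → ℂ) → ℝ) (z : Fin n → ℂ) : ℂ :=
  (1 / 2) * ((φ 0 : ℝ) : ℂ)
  + (∑ j : Fin n, wirtingerZ j (cplx φ) 0 * z j)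
  + (1 / 2) * ∑ j ∈ Finset.univ.filter (fun j : Fin n => (j : ℕ) < n - 1),
      ∑ k ∈ Finset.univ.filter (fun k : Fin n => (k : ℕ) < n - 1),
        wirtingerZ j (fun y => wirtingerZ k (cplx φ) y) 0 * z j * z k
  + (∑ j ∈ Finset.univ.filter (fun j : Fin n => (j : ℕ) < n - 1),
      wirtingerZ j (fun y => derivXn hn (cplx φ) y) 0 * z j * z (lastIdx n hn))
  + (1 / 4) * derivXn hn (fun y => derivXn hn (cplx φ) y) 0 * z (lastIdx n hn) ^ 2

/-- The anisotropic scaling `z(τ) = (τ⁻¹w', τ⁻¹ Re w_n + iτ⁻² Im w_n)`. -/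
noncomputable def zscale {n : ℕ} (hn : 2 ≤ n) (w : Fin n → ℂ) (τ : ℝ) : Fin n → ℂ :=
  fun j => if (j : ℕ) < n - 1 then (τ : ℂ)⁻¹ * w j
    else (τ : ℂ)⁻¹ * ((w j).re : ℂ) + Complex.I * ((τ : ℂ)⁻¹) ^ 2 * ((w j).im : ℂ)

open Filter Topology Asymptotics

/-- Second-order Taylor expansion with Peano remainder for a function that is `C²` at a point. -/
lemma ContDiffAt.taylor_two_isLittleO {E F : Type*} [NormedAddCommGroup E] [NormedSpace ℝ E]
    [NormedAddCommGroup F] [NormedSpace ℝ F] {f : E → F} {x : E} (hf : ContDiffAt ℝ 2 f x) :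
    (fun v => f (x + v) - f x - fderiv ℝ f x v - (1 / 2 : ℝ) • fderiv ℝ (fderiv ℝ f) x v v)
      =o[𝓝 0] fun v => ‖v‖ ^ 2 := by
  have hsymm : IsSymmSndFDerivAt ℝ f x := hf.isSymmSndFDerivAt (by simp)
  have hdiff : ∀ᶠ v in 𝓝 (0 : E), DifferentiableAt ℝ f (x + v) := by
    have h : ∀ᶠ y in 𝓝 x, DifferentiableAt ℝ f y :=
      (hf.eventually (by simp)).mono fun y hy => hy.differentiableAt (by simp)
    have ht : Tendsto (fun v => x + v) (𝓝 (0 : E)) (𝓝 x) := by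
      simpa using (continuous_const_add x).tendsto 0
    exact ht.eventually h
  have hf' : HasFDerivAt (fderiv ℝ f) (fderiv ℝ (fderiv ℝ f) x) x :=
    ((hf.fderiv_right (m := 1) (by norm_num)).differentiableAt (by simp)).hasFDerivAt
  rw [hasFDerivAt_iff_isLittleO_nhds_zero] at hf'
  rw [isLittleO_iff] at hf' ⊢
  intro ε hε
  obtain ⟨r, hr, hball⟩ := Metric.eventually_nhds_iff_ball.1 ((hf' hε).and hdiff)
  filter_upwards [Metric.ball_mem_nhds (0 : E) hr] with v hv
  set H := fderiv ℝ (fderiv ℝ f) x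
  have hmem : ∀ u ∈ Metric.closedBall (0 : E) ‖v‖, u ∈ Metric.ball (0 : E) r := fun u hu => by
    simp only [mem_closedBall_zero_iff, mem_ball_zero_iff] at *
    exact hu.trans_lt hv
  have hderiv : ∀ u ∈ Metric.closedBall (0 : E) ‖v‖, HasFDerivWithinAt
      (fun v => f (x + v) - f x - fderiv ℝ f x v - (1 / 2 : ℝ) • H v v)
      (fderiv ℝ f (x + u) - fderiv ℝ f x - H u) (Metric.closedBall (0 : E) ‖v‖) u := by
    intro u hu
    have h1 : HasFDerivAt (fun v => f (x + v)) (fderiv ℝ f (x + u)) u := by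
      have h := (hball u (hmem u hu)).2.hasFDerivAt
      exact h.comp u ((hasFDerivAt_id u).const_add x)
    have h2 := (H.hasFDerivAt (x := u)).clm_apply (hasFDerivAt_id u)
    refine (((h1.sub_const (f x)).sub (fderiv ℝ f x).hasFDerivAt).sub
      (h2.const_smul (1 / 2 : ℝ))).hasFDerivWithinAt.congr_fderiv ?_
    ext w
    have hs : H w u = H u w := hsymm w u
    simp only [sub_apply, smul_apply,
      add_apply, ContinuousLinearMap.comp_apply,
      ContinuousLinearMap.flip_apply, ContinuousLinearMap.id_apply, id, hs]
    module
  have hbound : ∀ u ∈ Metric.closedBall (0 : E) ‖v‖,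
      ‖fderiv ℝ f (x + u) - fderiv ℝ f x - H u‖ ≤ ε * ‖v‖ := fun u hu =>
    (hball u (hmem u hu)).1.trans (by
      have := mem_closedBall_zero_iff.1 hu
      gcongr)
  have := (convex_closedBall (0 : E) ‖v‖).norm_image_sub_le_of_norm_hasFDerivWithin_le
    hderiv hbound (x := 0) (y := v) (by simp) (by simp)
  simp only [add_zero, map_zero, sub_self, sub_zero, smul_zero] at this
  rw [norm_pow, norm_norm]
  linarith [this]

section Wirtinger

variable {n : ℕ}

lemma single_eq_re_smul_add_im_smul (j : Fin n) (a : ℂ) :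
    (Pi.single j a : Fin n → ℂ)
      = a.re • (Pi.single j 1 : Fin n → ℂ) + a.im • (Pi.single j Complex.I : Fin n → ℂ) := by
  simp only [← Pi.single_smul, ← Pi.single_add]
  congr 1
  simp [Complex.re_add_im]

lemma I_smul_single_eq (j : Fin n) (a : ℂ) :
    (Complex.I • Pi.single j a : Fin n → ℂ)
      = a.re • (Pi.single j Complex.I : Fin n → ℂ) - a.im • (Pi.single j 1 : Fin n → ℂ) := by
  simp only [← Pi.single_smul, ← Pi.single_sub]
  congr 1
  apply Complex.ext <;> simp

lemma sum_wirtinger_mul (L : (Fin n → ℂ) →L[ℝ] ℂ) (S : Finset (Fin n)) (w : Fin n → ℂ) :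
    ∑ j ∈ S, (1 / 2) * (L (Pi.single j 1) - Complex.I * L (Pi.single j Complex.I)) * w j
      = (1 / 2) * (L (∑ j ∈ S, Pi.single j (w j))
        - Complex.I * L (Complex.I • ∑ j ∈ S, Pi.single j (w j))) := by
  simp only [Finset.smul_sum, map_sum, Finset.mul_sum, ← Finset.sum_sub_distrib]
  refine Finset.sum_congr rfl fun j _ => ?_
  rw [I_smul_single_eq, single_eq_re_smul_add_im_smul j (w j)]
  simp only [map_add, map_sub, map_smul, Complex.real_smul]
  conv_lhs => rw [← Complex.re_add_im (w j)]
  linear_combination (-(w j).im * L (Pi.single j Complex.I) / 2) * Complex.I_sq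

lemma sum_wirtinger_mul_conj (L : (Fin n → ℂ) →L[ℝ] ℂ) (S : Finset (Fin n)) (w : Fin n → ℂ) :
    ∑ j ∈ S, (1 / 2) * (L (Pi.single j 1) + Complex.I * L (Pi.single j Complex.I))
        * (starRingEnd ℂ) (w j)
      = (1 / 2) * (L (∑ j ∈ S, Pi.single j (w j))
        + Complex.I * L (Complex.I • ∑ j ∈ S, Pi.single j (w j))) := by
  simp only [Finset.smul_sum, map_sum, Finset.mul_sum, ← Finset.sum_add_distrib]
  refine Finset.sum_congr rfl fun j _ => ?_
  rw [I_smul_single_eq, single_eq_re_smul_add_im_smul j (w j)]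
  simp only [map_add, map_sub, map_smul, Complex.real_smul]
  have hc : (starRingEnd ℂ) (w j) = (w j).re - (w j).im * Complex.I := by
    apply Complex.ext <;> simp
  rw [hc]
  linear_combination (-(w j).im * L (Pi.single j Complex.I) / 2) * Complex.I_sq

lemma sum_sum_wirtingerZ_mul (G : Fin n → (Fin n → ℂ) → ℂ) (M : (Fin n → ℂ) →L[ℝ] ℂ)
    (S T : Finset (Fin n)) (w c : Fin n → ℂ)
    (hM : ∀ u, ∑ k ∈ T, fderiv ℝ (G k) 0 u * c k = M u) :
    ∑ j ∈ S, ∑ k ∈ T, wirtingerZ j (G k) 0 * w j * c k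
      = (1 / 2) * (M (∑ j ∈ S, Pi.single j (w j))
        - Complex.I * M (Complex.I • ∑ j ∈ S, Pi.single j (w j))) := by
  rw [← sum_wirtinger_mul]
  refine Finset.sum_congr rfl fun j _ => ?_
  rw [← hM, ← hM, Finset.mul_sum, ← Finset.sum_sub_distrib, Finset.mul_sum, Finset.sum_mul]
  refine Finset.sum_congr rfl fun k _ => ?_
  rw [wirtingerZ]
  ring

variable {φ : (Fin n → ℂ) → ℝ}

lemma hasFDerivAt_fderiv_cplx_apply (hφ : ContDiffAt ℝ 2 φ 0) (v : Fin n → ℂ) :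
    HasFDerivAt (fun y => fderiv ℝ (cplx φ) y v)
      (Complex.ofRealCLM.comp ((fderiv ℝ (fderiv ℝ φ) 0).flip v)) 0 := by
  have hf' : HasFDerivAt (fderiv ℝ φ) (fderiv ℝ (fderiv ℝ φ) 0) 0 :=
    ((hφ.fderiv_right (m := 1) (by norm_num)).differentiableAt (by simp)).hasFDerivAt
  have h : HasFDerivAt (fun y => Complex.ofRealCLM (fderiv ℝ φ y v))
      (Complex.ofRealCLM.comp ((fderiv ℝ (fderiv ℝ φ) 0).flip v)) 0 := by
    refine Complex.ofRealCLM.hasFDerivAt.comp 0 ?_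
    exact (hf'.clm_apply (hasFDerivAt_const v 0)).congr_fderiv (by ext; simp)
  refine h.congr_of_eventuallyEq ?_
  filter_upwards [hφ.eventually (by simp)] with y hy
  have hy' := Complex.ofRealCLM.hasFDerivAt.comp y (hy.differentiableAt (by simp)).hasFDerivAt
  have : fderiv ℝ (cplx φ) y = Complex.ofRealCLM.comp (fderiv ℝ φ y) := hy'.fderiv
  simp [this]

lemma fderiv_fderiv_cplx_apply (hφ : ContDiffAt ℝ 2 φ 0) (u v : Fin n → ℂ) :
    fderiv ℝ (fun y => fderiv ℝ (cplx φ) y v) 0 u = (fderiv ℝ (fderiv ℝ φ) 0 u v : ℂ) := by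
  rw [(hasFDerivAt_fderiv_cplx_apply hφ v).fderiv]
  simp

lemma fderiv_cplx_zero_apply (hφ : ContDiffAt ℝ 2 φ 0) (v : Fin n → ℂ) :
    fderiv ℝ (cplx φ) 0 v = (fderiv ℝ φ 0 v : ℂ) := by
  have h := Complex.ofRealCLM.hasFDerivAt.comp 0 (hφ.differentiableAt (by simp)).hasFDerivAt
  have : fderiv ℝ (cplx φ) 0 = Complex.ofRealCLM.comp (fderiv ℝ φ 0) := h.fderiv
  simp [this]

lemma fderiv_wirtingerZ_cplx_apply (hφ : ContDiffAt ℝ 2 φ 0) (k : Fin n) (u : Fin n → ℂ) :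
    fderiv ℝ (fun y => wirtingerZ k (cplx φ) y) 0 u
      = (1 / 2) * ((fderiv ℝ (fderiv ℝ φ) 0 u (Pi.single k 1) : ℂ)
        - Complex.I * (fderiv ℝ (fderiv ℝ φ) 0 u (Pi.single k Complex.I) : ℂ)) := by
  have h := (((hasFDerivAt_fderiv_cplx_apply hφ (Pi.single k 1)).sub
    ((hasFDerivAt_fderiv_cplx_apply hφ (Pi.single k Complex.I)).const_mul Complex.I)).const_mul
      (1 / 2 : ℂ)).fderiv
  have h' := DFunLike.congr_fun h u
  exact h'.trans (by simp)

lemma fderiv_wirtingerZbar_cplx_apply (hφ : ContDiffAt ℝ 2 φ 0) (k : Fin n) (u : Fin n → ℂ) :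
    fderiv ℝ (fun y => wirtingerZbar k (cplx φ) y) 0 u
      = (1 / 2) * ((fderiv ℝ (fderiv ℝ φ) 0 u (Pi.single k 1) : ℂ)
        + Complex.I * (fderiv ℝ (fderiv ℝ φ) 0 u (Pi.single k Complex.I) : ℂ)) := by
  have h := (((hasFDerivAt_fderiv_cplx_apply hφ (Pi.single k 1)).add
    ((hasFDerivAt_fderiv_cplx_apply hφ (Pi.single k Complex.I)).const_mul Complex.I)).const_mul
      (1 / 2 : ℂ)).fderiv
  have h' := DFunLike.congr_fun h u
  exact h'.trans (by simp [mul_add])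

lemma sum_sum_wirtingerZ_wirtingerZ (hφ : ContDiffAt ℝ 2 φ 0) (S : Finset (Fin n))
    (w p : Fin n → ℂ) (hp : ∑ j ∈ S, Pi.single j (w j) = p) :
    ∑ j ∈ S, ∑ k ∈ S, wirtingerZ j (fun y => wirtingerZ k (cplx φ) y) 0 * w j * w k
      = (1 / 4) * ((fderiv ℝ (fderiv ℝ φ) 0 p p
          - fderiv ℝ (fderiv ℝ φ) 0 (Complex.I • p) (Complex.I • p) : ℝ)
        - Complex.I * (fderiv ℝ (fderiv ℝ φ) 0 p (Complex.I • p)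
          + fderiv ℝ (fderiv ℝ φ) 0 (Complex.I • p) p : ℝ)) := by
  set H := fderiv ℝ (fderiv ℝ φ) 0
  rw [sum_sum_wirtingerZ_mul _ ((1 / 2 : ℂ) • (Complex.ofRealCLM.comp (H.flip p)
    - Complex.I • Complex.ofRealCLM.comp (H.flip (Complex.I • p)))) S S w w, hp]
  · simp
    linear_combination ((H (Complex.I • p) (Complex.I • p) : ℝ) : ℂ) / 4 * Complex.I_sq
  · intro u
    have h := sum_wirtinger_mul (Complex.ofRealCLM.comp (H u)) S w
    rw [hp] at h
    simp only [fderiv_wirtingerZ_cplx_apply hφ]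
    exact h.trans (by simp)

lemma sum_sum_wirtingerZ_wirtingerZbar (hφ : ContDiffAt ℝ 2 φ 0) (S : Finset (Fin n))
    (w p : Fin n → ℂ) (hp : ∑ j ∈ S, Pi.single j (w j) = p) :
    ∑ j ∈ S, ∑ k ∈ S, wirtingerZ j (fun y => wirtingerZbar k (cplx φ) y) 0 * w j
        * (starRingEnd ℂ) (w k)
      = ((1 / 4 * (fderiv ℝ (fderiv ℝ φ) 0 p p
          + fderiv ℝ (fderiv ℝ φ) 0 (Complex.I • p) (Complex.I • p)) : ℝ) : ℂ) := by
  have hsymm : fderiv ℝ (fderiv ℝ φ) 0 p (Complex.I • p)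
      = fderiv ℝ (fderiv ℝ φ) 0 (Complex.I • p) p :=
    (hφ.isSymmSndFDerivAt (by simp) : IsSymmSndFDerivAt ℝ φ 0) _ _
  set H := fderiv ℝ (fderiv ℝ φ) 0
  rw [sum_sum_wirtingerZ_mul _ ((1 / 2 : ℂ) • (Complex.ofRealCLM.comp (H.flip p)
    + Complex.I • Complex.ofRealCLM.comp (H.flip (Complex.I • p)))) S S w
      (fun k => (starRingEnd ℂ) (w k)), hp]
  · simp [hsymm]
    linear_combination -((H (Complex.I • p) (Complex.I • p) : ℝ) : ℂ) / 4 * Complex.I_sq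
  · intro u
    have h := sum_wirtinger_mul_conj (Complex.ofRealCLM.comp (H u)) S w
    rw [hp] at h
    simp only [fderiv_wirtingerZbar_cplx_apply hφ]
    exact h.trans (by simp [mul_add])

lemma sum_wirtingerZ_derivXn (hn : 2 ≤ n) (hφ : ContDiffAt ℝ 2 φ 0) (S : Finset (Fin n))
    (w p : Fin n → ℂ) (hp : ∑ j ∈ S, Pi.single j (w j) = p) :
    ∑ j ∈ S, wirtingerZ j (fun y => derivXn hn (cplx φ) y) 0 * w j
      = (1 / 2) * ((fderiv ℝ (fderiv ℝ φ) 0 p (Pi.single (lastIdx n hn) 1) : ℂ)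
        - Complex.I
          * (fderiv ℝ (fderiv ℝ φ) 0 (Complex.I • p) (Pi.single (lastIdx n hn) 1) : ℂ)) := by
  have h := sum_wirtinger_mul (Complex.ofRealCLM.comp
    ((fderiv ℝ (fderiv ℝ φ) 0).flip (Pi.single (lastIdx n hn) 1))) S w
  rw [hp] at h
  simp only [wirtingerZ, derivXn, fderiv_fderiv_cplx_apply hφ]
  exact h

lemma sum_wirtingerZ_cplx (hφ : ContDiffAt ℝ 2 φ 0) (z : Fin n → ℂ) :
    ∑ j, wirtingerZ j (cplx φ) 0 * z j
      = (1 / 2) * ((fderiv ℝ φ 0 z : ℂ) - Complex.I * (fderiv ℝ φ 0 (Complex.I • z) : ℂ)) := by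
  have h := sum_wirtinger_mul (Complex.ofRealCLM.comp (fderiv ℝ φ 0)) Finset.univ z
  rw [Finset.univ_sum_single] at h
  simp only [wirtingerZ, fderiv_cplx_zero_apply hφ]
  exact h

lemma two_mul_re_Bpoly (hn : 2 ≤ n) (hφ : ContDiffAt ℝ 2 φ 0) (z p e : Fin n → ℂ)
    (hp : ∑ j ∈ Finset.univ.filter (fun j : Fin n => (j : ℕ) < n - 1), Pi.single j (z j) = p)
    (he : Pi.single (lastIdx n hn) 1 = e) :
    2 * (Bpoly hn φ z).re = φ 0 + fderiv ℝ φ 0 z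
      + 1 / 4 * (fderiv ℝ (fderiv ℝ φ) 0 p p
          - fderiv ℝ (fderiv ℝ φ) 0 (Complex.I • p) (Complex.I • p))
      + (fderiv ℝ (fderiv ℝ φ) 0 p e * (z (lastIdx n hn)).re
        + fderiv ℝ (fderiv ℝ φ) 0 (Complex.I • p) e * (z (lastIdx n hn)).im)
      + 1 / 2 * fderiv ℝ (fderiv ℝ φ) 0 e e
        * ((z (lastIdx n hn)).re ^ 2 - (z (lastIdx n hn)).im ^ 2) := by
  have hxx : derivXn hn (fun y => derivXn hn (cplx φ) y) 0
      = (fderiv ℝ (fderiv ℝ φ) 0 e e : ℂ) := by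
    simp only [derivXn, fderiv_fderiv_cplx_apply hφ, he]
  rw [Bpoly, sum_wirtingerZ_cplx hφ, sum_sum_wirtingerZ_wirtingerZ hφ _ z p hp,
    ← Finset.sum_mul, sum_wirtingerZ_derivXn hn hφ _ z p hp, hxx, he]
  simp [pow_two]
  ring

end Wirtinger

lemma zscale_eq_smul {n : ℕ} (hn : 2 ≤ n) (w u : Fin n → ℂ) (τ : ℝ)
    (hu : ∑ j ∈ Finset.univ.filter (fun j : Fin n => (j : ℕ) < n - 1), Pi.single j (w j) = u) :
    zscale hn w τ = τ⁻¹ • ((u + (w (lastIdx n hn)).re • (Pi.single (lastIdx n hn) 1 : Fin n → ℂ))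
      + τ⁻¹ • (w (lastIdx n hn)).im • (Pi.single (lastIdx n hn) Complex.I : Fin n → ℂ)) := by
  subst hu
  funext j
  by_cases hj : (j : ℕ) < n - 1
  · have hne : j ≠ lastIdx n hn := fun h => by simp [h, lastIdx] at hj
    simp [zscale, hj, Finset.sum_apply, Finset.sum_pi_single, hne]
  · have heq : j = lastIdx n hn := Fin.ext (by simp only [lastIdx]; omega)
    subst heq
    simp [zscale, Finset.sum_apply, Finset.sum_pi_single, hj]
    ring

lemma sum_single_zscale {n : ℕ} (hn : 2 ≤ n) (w : Fin n → ℂ) (τ : ℝ) :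
    ∑ j ∈ Finset.univ.filter (fun j : Fin n => (j : ℕ) < n - 1), Pi.single j (zscale hn w τ j)
      = τ⁻¹ • ∑ j ∈ Finset.univ.filter (fun j : Fin n => (j : ℕ) < n - 1),
          (Pi.single j (w j) : Fin n → ℂ) := by
  rw [Finset.smul_sum]
  refine Finset.sum_congr rfl fun j hj => ?_
  rw [← Pi.single_smul]
  congr 1
  simp [zscale, (Finset.mem_filter.1 hj).2]

lemma zscale_lastIdx {n : ℕ} (hn : 2 ≤ n) (w : Fin n → ℂ) (τ : ℝ) :
    (zscale hn w τ (lastIdx n hn)).re = τ⁻¹ * (w (lastIdx n hn)).re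
      ∧ (zscale hn w τ (lastIdx n hn)).im = τ⁻¹ ^ 2 * (w (lastIdx n hn)).im := by
  have h : zscale hn w τ (lastIdx n hn)
      = ((τ⁻¹ * (w (lastIdx n hn)).re : ℝ) : ℂ)
        + ((τ⁻¹ ^ 2 * (w (lastIdx n hn)).im : ℝ) : ℂ) * Complex.I := by
    simp [zscale, lastIdx]
    ring
  rw [h]
  constructor <;> simp [-Complex.ofReal_mul, -Complex.ofReal_pow, -Complex.ofReal_inv]

/-- The anisotropic scaling limit `lim_{τ→∞} τ²(φ(z(τ)) - 2 Re B(z(τ)))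
  = Σ_{j,k=1}^{n-1} ∂²φ/∂z_j∂z̄_k(0) w_j w̄_k`. -/
theorem stmt_14 {n : ℕ} (hn : 2 ≤ n) (φ : (Fin n → ℂ) → ℝ)
    (hφ : ContDiffAt ℝ 2 φ 0) (w : Fin n → ℂ) :
    Filter.Tendsto
      (fun τ : ℝ => (τ : ℂ) ^ 2 *
        (((φ (zscale hn w τ) : ℝ) : ℂ) - 2 * (((Bpoly hn φ (zscale hn w τ)).re : ℝ) : ℂ)))
      Filter.atTop
      (nhds (∑ j ∈ Finset.univ.filter (fun j : Fin n => (j : ℕ) < n - 1),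
        ∑ k ∈ Finset.univ.filter (fun k : Fin n => (k : ℕ) < n - 1),
          wirtingerZ j (fun y => wirtingerZbar k (cplx φ) y) 0 * w j
            * (starRingEnd ℂ) (w k))) := by

  set l := lastIdx n hn
  obtain ⟨u, hu⟩ : ∃ u : Fin n → ℂ, ∑ j ∈ Finset.univ.filter
    (fun j : Fin n => (j : ℕ) < n - 1), Pi.single j (w j) = u := ⟨_, rfl⟩
  obtain ⟨e, he⟩ : ∃ e : Fin n → ℂ, Pi.single l 1 = e := ⟨_, rfl⟩
  obtain ⟨f, hf⟩ : ∃ f : Fin n → ℂ, Pi.single l Complex.I = f := ⟨_, rfl⟩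
  have hsymm : IsSymmSndFDerivAt ℝ φ 0 := hφ.isSymmSndFDerivAt (by simp)
  have htaylor := hφ.taylor_two_isLittleO
  have hB := fun τ => two_mul_re_Bpoly hn hφ (zscale hn w τ) (τ⁻¹ • u) e
    (by rw [sum_single_zscale, hu]) he
  rw [sum_sum_wirtingerZ_wirtingerZbar hφ _ w u hu]
  set D := fderiv ℝ φ 0
  set H := fderiv ℝ (fderiv ℝ φ) 0
  set R : (Fin n → ℂ) → ℝ := fun v => φ (0 + v) - φ 0 - D v - (1 / 2 : ℝ) • H v v with hR
  set x := (w l).re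
  set b := (w l).im
  set q : ℝ → Fin n → ℂ := fun s => (u + x • e) + s • b • f with hq
  have hqc : Continuous q := by fun_prop
  have hz : ∀ τ, zscale hn w τ = τ⁻¹ • q τ⁻¹ := fun τ => by
    rw [zscale_eq_smul hn w u τ hu, hq, ← he, ← hf]
  have hrem : Tendsto (fun s : ℝ => R (s • q s) / s ^ 2) (𝓝 0) (𝓝 0) := by
    have ht : Tendsto (fun s : ℝ => s • q s) (𝓝 0) (𝓝 0) := by
      have hc : Continuous fun s : ℝ => s • q s := by fun_prop
      simpa using hc.tendsto 0
    have hO : (fun s : ℝ => s • q s) =O[𝓝 0] fun s => s := by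
      simpa using (isBigO_refl (fun s : ℝ => s) (𝓝 0)).smul
        (hqc.continuousAt (x := 0).norm.isBoundedUnder_le.isBigO_one ℝ)
    exact ((htaylor.comp_tendsto ht).trans_isBigO (hO.norm_left.pow 2)).tendsto_div_nhds_zero
  set P : ℝ → ℝ := fun s => 1 / 2 * H (q s) (q s)
    - 1 / 4 * (H u u - H (Complex.I • u) (Complex.I • u)) - H u e * x
    - s * b * H (Complex.I • u) e - 1 / 2 * H e e * (x ^ 2 - s ^ 2 * b ^ 2) with hP
  have hPc : Continuous P := by fun_prop
  have hP0 : P 0 = 1 / 4 * (H u u + H (Complex.I • u) (Complex.I • u)) := by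
    have hs : H e u = H u e := hsymm e u
    simp [hP, hq, hs]
    ring
  have hlim : Tendsto (fun τ : ℝ => R (τ⁻¹ • q τ⁻¹) / τ⁻¹ ^ 2 + P τ⁻¹) atTop
      (𝓝 (1 / 4 * (H u u + H (Complex.I • u) (Complex.I • u)))) := by
    have h := (hrem.add (hPc.tendsto 0)).comp tendsto_inv_atTop_zero
    rwa [zero_add, hP0] at h
  refine ((Complex.continuous_ofReal.tendsto _).comp hlim).congr' ?_
  filter_upwards [eventually_gt_atTop 0] with τ hτ
  have key : R (τ⁻¹ • q τ⁻¹) / τ⁻¹ ^ 2 + P τ⁻¹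
      = τ ^ 2 * (φ (zscale hn w τ) - 2 * (Bpoly hn φ (zscale hn w τ)).re) := by
    rw [hB, (zscale_lastIdx hn w τ).1, (zscale_lastIdx hn w τ).2, hz]
    simp only [hR, hP, zero_add, map_smul, smul_apply, smul_eq_mul, smul_comm Complex.I τ⁻¹ u]
    field_simp
    ring
  simp only [Function.comp_apply, key]
  push_cast
  ring
end
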